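/- arXiv:1209.0527 — 2 statements merged into one kernel-verified Lean document; each statement's English description precedes it below -/
import Mathlib

section
/- Let M ≥ 2, u ∈ ℝ³ and u_th > 0, and let f : ℝ³ → ℝ be a finite Hermite expansion f(v) = Σ_{|α| ≤ M} f_α 𝓗_{u_th,α}(ξ) with ξ = (v − u)/√u_th, where u and u_th coincide with the macroscopic velocity and thermal velocity of f and the density ρ of f is positive. Then f_0 = ρ, f_{e_i} = 0 for i = 1,2,3, and Σ_{d=1}^{3} f_{2e_d} = 0. -/
open MeasureTheory Real

/-- Probabilists' Hermite polynomial `He_n(x) = (-1)^n e^{x²/2} dⁿ/dxⁿ e^{-x²/2}`,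
extended by `0` for negative indices. -/
noncomputable def He (n : ℤ) (x : ℝ) : ℝ :=
  if n < 0 then 0
  else (-1 : ℝ) ^ n.toNat * Real.exp (x ^ 2 / 2) *
    iteratedDeriv n.toNat (fun y => Real.exp (-(y ^ 2) / 2)) x

/-- Hermite basis function `𝓗_{uth,α}(ξ)`; it vanishes whenever a component of
the multi-index `α` is negative. -/
noncomputable def hermiteH (uth : ℝ) (α : Fin 3 → ℤ) (ξ : Fin 3 → ℝ) : ℝ :=
  ∏ d : Fin 3, (Real.sqrt (2 * π))⁻¹ * uth ^ ((-(α d : ℝ) - 1) / 2) *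
    He (α d) (ξ d) * Real.exp (-(ξ d) ^ 2 / 2)

/-- The set of multi-indices `α ∈ ℕ³` with `|α| ≤ M`. -/
def multiIndices (M : ℕ) : Finset (Fin 3 → ℕ) :=
  (Finset.Icc 0 fun _ => M).filter fun α => ∑ d, α d ≤ M


section Helpers

open Polynomial

/-- The product of the Hermite polynomial of degree `n` with the Gaussian weight. -/
noncomputable def hermiteGaussian (n : ℕ) (x : ℝ) : ℝ :=
  aeval x (hermite n) * Real.exp (-x ^ 2 / 2)

lemma He_natCast (n : ℕ) (x : ℝ) : He (n : ℤ) x = aeval x (hermite n) := by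
  rw [hermite_eq_deriv_gaussian', He, if_neg (by simp), iteratedDeriv_eq_iterate]
  simp only [Int.toNat_natCast, neg_div]
  ring

lemma hasDerivAt_hermiteGaussian (n : ℕ) (x : ℝ) :
    HasDerivAt (hermiteGaussian n) (-hermiteGaussian (n + 1) x) x := by
  have h1 := (hermite n).hasDerivAt_aeval x
  have h2 : HasDerivAt (fun y : ℝ => Real.exp (-y ^ 2 / 2)) (Real.exp (-x ^ 2 / 2) * -x) x := by
    have h3 : HasDerivAt (fun y : ℝ => -y ^ 2 / 2) (-x) x := by
      refine ((hasDerivAt_pow 2 x).neg.div_const 2).congr_deriv ?_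
      norm_num
      ring
    exact h3.exp
  refine (h1.mul h2).congr_deriv ?_
  simp only [hermiteGaussian, hermite_succ, map_sub, map_mul, aeval_X]
  ring

lemma integrable_pow_mul_gaussian (k : ℕ) :
    Integrable fun x : ℝ => x ^ k * Real.exp (-x ^ 2 / 2) := by
  have h := integrable_rpow_mul_exp_neg_mul_sq (b := 1 / 2) (by norm_num) (s := k)
    (by have : (0 : ℝ) ≤ k := k.cast_nonneg
        linarith)
  refine h.congr (Filter.Eventually.of_forall fun x => ?_)
  simp only [Real.rpow_natCast]
  congr 2
  ring

lemma integrable_pow_mul_hermiteGaussian (k n : ℕ) :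
    Integrable fun x : ℝ => x ^ k * hermiteGaussian n x := by
  have h : ∀ x : ℝ, x ^ k * hermiteGaussian n x = ∑ i ∈ Finset.range ((hermite n).natDegree + 1),
      ((hermite n).coeff i : ℝ) * (x ^ (k + i) * Real.exp (-x ^ 2 / 2)) := by
    intro x
    rw [hermiteGaussian, aeval_eq_sum_range, Finset.sum_mul, Finset.mul_sum]
    refine Finset.sum_congr rfl fun i _ => ?_
    rw [zsmul_eq_mul]
    ring
  simp_rw [h]
  exact integrable_finsetSum _ fun i _ => (integrable_pow_mul_gaussian _).const_mul _

/-- The moment of order `k` of `hermiteGaussian n`. -/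
noncomputable def hermiteMoment (k n : ℕ) : ℝ := ∫ x : ℝ, x ^ k * hermiteGaussian n x

lemma hermiteMoment_zero_zero : hermiteMoment 0 0 = √(2 * π) := by
  have h := integral_gaussian (1 / 2)
  have h2 : π / (1 / 2) = 2 * π := by ring
  rw [h2] at h
  rw [← h, hermiteMoment]
  congr 1
  ext x
  simp only [hermiteGaussian, hermite_zero, map_one, pow_zero, one_mul]
  congr 1
  ring

lemma hermiteMoment_zero_succ (n : ℕ) : hermiteMoment 0 (n + 1) = 0 := by
  have hi := fun m => integrable_pow_mul_hermiteGaussian 0 m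
  simp only [pow_zero, one_mul] at hi
  have h := integral_eq_zero_of_hasDerivAt_of_integrable (hasDerivAt_hermiteGaussian n)
    (hi (n + 1)).neg (hi n)
  rw [integral_neg, neg_eq_zero] at h
  simpa [hermiteMoment] using h

lemma hermiteMoment_succ_zero (k : ℕ) : hermiteMoment (k + 1) 0 = hermiteMoment k 1 := by
  simp only [hermiteMoment, hermiteGaussian, hermite_zero, hermite_one, map_one, aeval_X]
  congr 1
  ext x
  ring

lemma hermiteMoment_succ_succ (k n : ℕ) :
    hermiteMoment (k + 1) (n + 1) = (k + 1) * hermiteMoment k n := by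
  have hd : ∀ x : ℝ, HasDerivAt (fun y : ℝ => y ^ (k + 1)) ((k + 1) * x ^ k) x := fun x => by
    simpa using hasDerivAt_pow (k + 1) x
  have h := integral_mul_deriv_eq_deriv_mul_of_integrable (fun x _ => hd x)
    (fun x _ => hasDerivAt_hermiteGaussian n x)
    ((integrable_pow_mul_hermiteGaussian (k + 1) (n + 1)).neg.congr
      (Filter.Eventually.of_forall fun x => by simp))
    (((integrable_pow_mul_hermiteGaussian k n).const_mul (k + 1 : ℝ)).congr
      (Filter.Eventually.of_forall fun x => by simp [mul_assoc]))
    (integrable_pow_mul_hermiteGaussian (k + 1) n)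
  simp only [mul_neg, integral_neg, neg_inj, mul_assoc, integral_const_mul] at h
  exact h

/-- The one-dimensional factor of the Hermite basis function centred at `u`. -/
noncomputable def hermiteFactor (uth u : ℝ) (n : ℕ) (v : ℝ) : ℝ :=
  (√(2 * π))⁻¹ * uth ^ ((-(n : ℝ) - 1) / 2) * hermiteGaussian n ((v - u) / √uth)

lemma hermiteH_eq_prod_hermiteFactor (uth : ℝ) (u v : Fin 3 → ℝ) (α : Fin 3 → ℕ) :
    hermiteH uth (fun d => (α d : ℤ)) (fun d => (v d - u d) / √uth) =
      ∏ d, hermiteFactor uth (u d) (α d) (v d) := by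
  refine Finset.prod_congr rfl fun d _ => ?_
  rw [He_natCast, hermiteFactor, hermiteGaussian]
  push_cast
  ring

lemma sub_pow_mul_hermiteFactor {uth : ℝ} (h : 0 < uth) (u : ℝ) (k n : ℕ) (v : ℝ) :
    (v - u) ^ k * hermiteFactor uth u n v =
      (√(2 * π))⁻¹ * uth ^ ((-(n : ℝ) - 1) / 2) * √uth ^ k *
        (((v - u) / √uth) ^ k * hermiteGaussian n ((v - u) / √uth)) := by
  have hs : √uth ≠ 0 := (Real.sqrt_pos.2 h).ne'
  rw [hermiteFactor, div_pow]
  field_simp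

lemma integrable_sub_pow_mul_hermiteFactor {uth : ℝ} (h : 0 < uth) (u : ℝ) (k n : ℕ) :
    Integrable fun v : ℝ => (v - u) ^ k * hermiteFactor uth u n v := by
  simp_rw [sub_pow_mul_hermiteFactor h]
  exact (((integrable_pow_mul_hermiteGaussian k n).comp_div
    (Real.sqrt_pos.2 h).ne').comp_sub_right u).const_mul _

lemma integral_sub_pow_mul_hermiteFactor {uth : ℝ} (h : 0 < uth) (u : ℝ) (k n : ℕ) :
    ∫ v : ℝ, (v - u) ^ k * hermiteFactor uth u n v =
      (√(2 * π))⁻¹ * uth ^ (((k : ℝ) - n) / 2) * hermiteMoment k n := by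
  simp_rw [sub_pow_mul_hermiteFactor h]
  rw [integral_const_mul, integral_sub_right_eq_self
    (fun v : ℝ => (v / √uth) ^ k * hermiteGaussian n (v / √uth)),
    Measure.integral_comp_div (fun v : ℝ => v ^ k * hermiteGaussian n v),
    abs_of_nonneg (Real.sqrt_nonneg _), smul_eq_mul, ← hermiteMoment]
  have hp : uth ^ ((-(n : ℝ) - 1) / 2) * √uth ^ k * √uth = uth ^ (((k : ℝ) - n) / 2) := by
    rw [mul_assoc, ← pow_succ, Real.sqrt_eq_rpow, ← Real.rpow_natCast, ← Real.rpow_mul h.le,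
      ← Real.rpow_add h]
    congr 1
    push_cast
    ring
  rw [← hp]
  ring

/-- The normalised moment of order `k` of `hermiteFactor uth u n` about its centre `u`. -/
noncomputable def scaledHermiteMoment (uth : ℝ) (k n : ℕ) : ℝ :=
  (√(2 * π))⁻¹ * uth ^ (((k : ℝ) - n) / 2) * hermiteMoment k n

lemma sqrt_two_pi_ne_zero : √(2 * π) ≠ 0 := (Real.sqrt_pos.2 (by positivity)).ne'

lemma hermiteMoment_of_lt {k n : ℕ} (h : k < n) : hermiteMoment k n = 0 := by
  induction k generalizing n with
  | zero =>
    obtain ⟨m, rfl⟩ := Nat.exists_eq_succ_of_ne_zero h.ne'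
    exact hermiteMoment_zero_succ m
  | succ k ih =>
    obtain ⟨m, rfl⟩ := Nat.exists_eq_succ_of_ne_zero (Nat.ne_zero_of_lt h)
    rw [Nat.succ_eq_add_one, hermiteMoment_succ_succ, ih (by omega), mul_zero]

lemma scaledHermiteMoment_of_lt (uth : ℝ) {k n : ℕ} (h : k < n) :
    scaledHermiteMoment uth k n = 0 := by
  rw [scaledHermiteMoment, hermiteMoment_of_lt h, mul_zero]

lemma scaledHermiteMoment_zero_zero (uth : ℝ) : scaledHermiteMoment uth 0 0 = 1 := by
  rw [scaledHermiteMoment, hermiteMoment_zero_zero, sub_self, zero_div, Real.rpow_zero, mul_one,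
    inv_mul_cancel₀ sqrt_two_pi_ne_zero]

lemma scaledHermiteMoment_one_zero (uth : ℝ) : scaledHermiteMoment uth 1 0 = 0 := by
  rw [scaledHermiteMoment, hermiteMoment_succ_zero, hermiteMoment_zero_succ, mul_zero]

lemma scaledHermiteMoment_one_one (uth : ℝ) : scaledHermiteMoment uth 1 1 = 1 := by
  rw [scaledHermiteMoment, hermiteMoment_succ_succ, hermiteMoment_zero_zero, sub_self, zero_div,
    Real.rpow_zero]
  have := sqrt_two_pi_ne_zero
  field_simp
  simp

lemma scaledHermiteMoment_two_zero (uth : ℝ) : scaledHermiteMoment uth 2 0 = uth := by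
  rw [scaledHermiteMoment, hermiteMoment_succ_zero, hermiteMoment_succ_succ,
    hermiteMoment_zero_zero]
  have := sqrt_two_pi_ne_zero
  field_simp
  simp

lemma scaledHermiteMoment_two_one (uth : ℝ) : scaledHermiteMoment uth 2 1 = 0 := by
  rw [scaledHermiteMoment, hermiteMoment_succ_succ, hermiteMoment_succ_zero,
    hermiteMoment_zero_succ, mul_zero, mul_zero]

lemma scaledHermiteMoment_two_two (uth : ℝ) : scaledHermiteMoment uth 2 2 = 2 := by
  rw [scaledHermiteMoment, hermiteMoment_succ_succ, hermiteMoment_succ_succ,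
    hermiteMoment_zero_zero, sub_self, zero_div, Real.rpow_zero]
  have := sqrt_two_pi_ne_zero
  field_simp
  norm_num

/-- The partial sum of the Hermite series with coefficients `c` centred at `u`. -/
noncomputable def hermiteSum (M : ℕ) (uth : ℝ) (u : Fin 3 → ℝ) (c : (Fin 3 → ℕ) → ℝ)
    (v : Fin 3 → ℝ) : ℝ :=
  ∑ α ∈ multiIndices M, c α *
    hermiteH uth (fun d => (α d : ℤ)) (fun d => (v d - u d) / √uth)

lemma prod_sub_pow_mul_hermiteSum (M : ℕ) (uth : ℝ) (u : Fin 3 → ℝ) (c : (Fin 3 → ℕ) → ℝ)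
    (k : Fin 3 → ℕ) (v : Fin 3 → ℝ) :
    (∏ d, (v d - u d) ^ k d) * hermiteSum M uth u c v =
      ∑ α ∈ multiIndices M, c α *
        ∏ d, (v d - u d) ^ k d * hermiteFactor uth (u d) (α d) (v d) := by
  rw [hermiteSum, Finset.mul_sum]
  refine Finset.sum_congr rfl fun α _ => ?_
  rw [hermiteH_eq_prod_hermiteFactor, Finset.prod_mul_distrib]
  ring

lemma integrable_prod_sub_pow_mul {uth : ℝ} (h : 0 < uth) (u : Fin 3 → ℝ) (k α : Fin 3 → ℕ) :
    Integrable fun v : Fin 3 → ℝ =>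
      ∏ d, (v d - u d) ^ k d * hermiteFactor uth (u d) (α d) (v d) :=
  Integrable.fintype_prod
    (f := fun d (x : ℝ) => (x - u d) ^ k d * hermiteFactor uth (u d) (α d) x)
    fun d => integrable_sub_pow_mul_hermiteFactor h (u d) (k d) (α d)

lemma integrable_prod_sub_pow_mul_hermiteSum {uth : ℝ} (h : 0 < uth) (M : ℕ)
    (u : Fin 3 → ℝ) (c : (Fin 3 → ℕ) → ℝ) (k : Fin 3 → ℕ) :
    Integrable fun v : Fin 3 → ℝ => (∏ d, (v d - u d) ^ k d) * hermiteSum M uth u c v := by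
  simp_rw [prod_sub_pow_mul_hermiteSum]
  exact integrable_finsetSum _ fun α _ => (integrable_prod_sub_pow_mul h u k α).const_mul _

lemma integral_prod_sub_pow_mul_hermiteSum {uth : ℝ} (h : 0 < uth) (M : ℕ)
    (u : Fin 3 → ℝ) (c : (Fin 3 → ℕ) → ℝ) (k : Fin 3 → ℕ) :
    ∫ v : Fin 3 → ℝ, (∏ d, (v d - u d) ^ k d) * hermiteSum M uth u c v =
      ∑ α ∈ multiIndices M, c α * ∏ d, scaledHermiteMoment uth (k d) (α d) := by
  simp_rw [prod_sub_pow_mul_hermiteSum]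
  rw [integral_finsetSum _ fun α _ => (integrable_prod_sub_pow_mul h u k α).const_mul _]
  refine Finset.sum_congr rfl fun α _ => ?_
  rw [integral_const_mul, integral_fintype_prod_volume_eq_prod
    fun d (x : ℝ) => (x - u d) ^ k d * hermiteFactor uth (u d) (α d) x]
  simp_rw [integral_sub_pow_mul_hermiteFactor h, scaledHermiteMoment]

lemma sum_mul_prod_scaledHermiteMoment_axis {M m : ℕ} (hm : m ≤ M) (uth : ℝ)
    (c : (Fin 3 → ℕ) → ℝ) (i : Fin 3) :
    ∑ α ∈ multiIndices M, c α * ∏ d, scaledHermiteMoment uth (if d = i then m else 0) (α d) =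
      ∑ n ∈ Finset.range (m + 1),
        c (fun j => if j = i then n else 0) * scaledHermiteMoment uth m n := by
  symm
  refine Finset.sum_of_injOn (fun n j => if j = i then n else 0) ?_ ?_ ?_ ?_
  · intro a _ b _ hab
    simpa using congrFun hab i
  · intro n hn
    have hn' : n ≤ M := by
      have := Finset.mem_range.1 hn
      omega
    simp only [multiIndices, Finset.coe_filter, Set.mem_ofPred_eq, Finset.mem_Icc]
    refine ⟨⟨fun j => Nat.zero_le _, fun j => ?_⟩, by simpa using hn'⟩
    show (if j = i then n else 0) ≤ M
    split_ifs <;> omega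
  · intro α _ hα
    have : ∃ d, (if d = i then m else 0) < α d := by
      by_contra! hle
      refine hα ⟨α i, ?_, ?_⟩
      · have := hle i
        simp only [if_true] at this
        simpa using Nat.lt_succ_of_le this
      · funext j
        have := hle j
        by_cases hj : j = i
        · simp [hj]
        · simp only [hj, if_false] at this ⊢
          omega
    obtain ⟨d, hd⟩ := this
    rw [Finset.prod_eq_zero (Finset.mem_univ d) (scaledHermiteMoment_of_lt uth hd), mul_zero]
  · intro n _
    dsimp only
    rw [Finset.prod_eq_single i]
    · simp
    · intro j _ hj
      simp [hj, scaledHermiteMoment_zero_zero]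
    · simp

lemma prod_sub_pow_axis (u v : Fin 3 → ℝ) (i : Fin 3) (m : ℕ) :
    ∏ d, (v d - u d) ^ (if d = i then m else 0) = (v i - u i) ^ m := by
  rw [Finset.prod_eq_single i]
  · simp
  · intro j _ hj
    simp [hj]
  · simp

lemma integrable_sub_pow_mul_hermiteSum {uth : ℝ} (h : 0 < uth) (M : ℕ) (u : Fin 3 → ℝ)
    (c : (Fin 3 → ℕ) → ℝ) (i : Fin 3) (m : ℕ) :
    Integrable fun v : Fin 3 → ℝ => (v i - u i) ^ m * hermiteSum M uth u c v := by
  simpa only [prod_sub_pow_axis] using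
    integrable_prod_sub_pow_mul_hermiteSum h M u c fun d => if d = i then m else 0

lemma integral_sub_pow_mul_hermiteSum {uth : ℝ} (h : 0 < uth) {M m : ℕ} (hm : m ≤ M)
    (u : Fin 3 → ℝ) (c : (Fin 3 → ℕ) → ℝ) (i : Fin 3) :
    ∫ v : Fin 3 → ℝ, (v i - u i) ^ m * hermiteSum M uth u c v =
      ∑ n ∈ Finset.range (m + 1),
        c (fun j => if j = i then n else 0) * scaledHermiteMoment uth m n := by
  rw [← sum_mul_prod_scaledHermiteMoment_axis hm,
    ← integral_prod_sub_pow_mul_hermiteSum h M u c fun d => if d = i then m else 0]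
  simp only [prod_sub_pow_axis]

lemma integral_hermiteSum {uth : ℝ} (h : 0 < uth) (M : ℕ) (u : Fin 3 → ℝ)
    (c : (Fin 3 → ℕ) → ℝ) : ∫ v : Fin 3 → ℝ, hermiteSum M uth u c v = c 0 := by
  have := integral_sub_pow_mul_hermiteSum h (Nat.zero_le M) u c 0
  simp only [pow_zero, one_mul, zero_add, Finset.sum_range_one, ite_self,
    scaledHermiteMoment_zero_zero, mul_one] at this
  exact this

lemma integral_sub_mul_hermiteSum {uth : ℝ} (h : 0 < uth) {M : ℕ} (hM : 1 ≤ M) (u : Fin 3 → ℝ)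
    (c : (Fin 3 → ℕ) → ℝ) (i : Fin 3) :
    ∫ v : Fin 3 → ℝ, (v i - u i) * hermiteSum M uth u c v =
      c fun j => if j = i then 1 else 0 := by
  have := integral_sub_pow_mul_hermiteSum h hM u c i
  simpa [Finset.sum_range_succ, scaledHermiteMoment_one_zero,
    scaledHermiteMoment_one_one] using this

lemma integral_sub_sq_mul_hermiteSum {uth : ℝ} (h : 0 < uth) {M : ℕ} (hM : 2 ≤ M)
    (u : Fin 3 → ℝ) (c : (Fin 3 → ℕ) → ℝ) (i : Fin 3) :
    ∫ v : Fin 3 → ℝ, (v i - u i) ^ 2 * hermiteSum M uth u c v =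
      c 0 * uth + 2 * c fun j => if j = i then 2 else 0 := by
  rw [integral_sub_pow_mul_hermiteSum h hM u c i]
  simp only [Finset.sum_range_succ, Finset.sum_range_zero, zero_add, ite_self,
    scaledHermiteMoment_two_zero, scaledHermiteMoment_two_one, scaledHermiteMoment_two_two,
    mul_zero, add_zero]
  rw [mul_comm 2]
  rfl

lemma integral_mul_hermiteSum {uth : ℝ} (h : 0 < uth) {M : ℕ} (hM : 1 ≤ M) (u : Fin 3 → ℝ)
    (c : (Fin 3 → ℕ) → ℝ) (i : Fin 3) :
    ∫ v : Fin 3 → ℝ, v i * hermiteSum M uth u c v =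
      (c fun j => if j = i then 1 else 0) + u i * c 0 := by
  have h0 := integrable_sub_pow_mul_hermiteSum h M u c i 0
  have h1 := integrable_sub_pow_mul_hermiteSum h M u c i 1
  simp only [pow_zero, pow_one, one_mul] at h0 h1
  rw [← integral_sub_mul_hermiteSum h hM u c i, ← integral_hermiteSum h M u c, ← integral_const_mul,
    ← integral_add h1 (h0.const_mul _)]
  congr 1
  ext v
  ring

lemma integral_sq_mul_hermiteSum {uth : ℝ} (h : 0 < uth) {M : ℕ} (hM : 2 ≤ M) (u : Fin 3 → ℝ)
    (c : (Fin 3 → ℕ) → ℝ) :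
    ∫ v : Fin 3 → ℝ, (∑ i, v i ^ 2) * hermiteSum M uth u c v =
      ∑ i, ((c 0 * uth + 2 * c fun j => if j = i then 2 else 0) +
        2 * u i * (c fun j => if j = i then 1 else 0) + u i ^ 2 * c 0) := by
  have h0 := integrable_sub_pow_mul_hermiteSum h M u c 0 0
  have h1 := fun i => integrable_sub_pow_mul_hermiteSum h M u c i 1
  have h2 := fun i => integrable_sub_pow_mul_hermiteSum h M u c i 2
  simp only [pow_zero, pow_one, one_mul] at h0 h1
  have hexp : ∀ v : Fin 3 → ℝ, (∑ i, v i ^ 2) * hermiteSum M uth u c v =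
      ∑ i, ((v i - u i) ^ 2 * hermiteSum M uth u c v +
        2 * u i * ((v i - u i) * hermiteSum M uth u c v) +
        u i ^ 2 * hermiteSum M uth u c v) := fun v => by
    rw [Finset.sum_mul]
    exact Finset.sum_congr rfl fun i _ => by ring
  have h12 : ∀ i, Integrable fun v : Fin 3 → ℝ => (v i - u i) ^ 2 * hermiteSum M uth u c v +
      2 * u i * ((v i - u i) * hermiteSum M uth u c v) :=
    fun i => (h2 i).add ((h1 i).const_mul _)
  simp_rw [hexp]
  rw [integral_finsetSum _ fun i _ => by exact (h12 i).add (h0.const_mul _)]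
  refine Finset.sum_congr rfl fun i _ => ?_
  rw [integral_add (h12 i) (h0.const_mul _),
    integral_add (h2 i) ((h1 i).const_mul _), integral_const_mul, integral_const_mul,
    integral_sub_sq_mul_hermiteSum h hM, integral_sub_mul_hermiteSum h (by omega),
    integral_hermiteSum h]

end Helpers

/-- When the expansion center of a finite Hermite expansion coincides with its
own macroscopic velocity and thermal velocity, the low-order coefficients are
`f_0 = ρ`, `f_{e_i} = 0` and `∑_d f_{2e_d} = 0`. -/
theorem hermite_expansion_compatibility
    (M : ℕ) (hM : 2 ≤ M)
    (u : Fin 3 → ℝ) (uth : ℝ) (huth : 0 < uth)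
    (c : (Fin 3 → ℕ) → ℝ) (f : (Fin 3 → ℝ) → ℝ)
    -- `f` is the finite Hermite expansion with coefficients `c α = f_α`
    (hf : ∀ v, f v = ∑ α ∈ multiIndices M, c α *
      hermiteH uth (fun d => (α d : ℤ)) (fun d => (v d - u d) / Real.sqrt uth))
    (ρ : ℝ) (hρpos : 0 < ρ)
    -- `ρ, u, uth` are the density, macroscopic velocity and thermal velocity of `f`
    (hρ : ρ = ∫ v, f v)
    (hu : ∀ d, ρ * u d = ∫ v, v d * f v)
    (huth : ρ * (∑ d, u d ^ 2) + 3 * ρ * uth = ∫ v, (∑ d, v d ^ 2) * f v) :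
    c 0 = ρ ∧
    (∀ i : Fin 3, c (fun j => if j = i then 1 else 0) = 0) ∧
    (∑ d : Fin 3, c fun j => if j = d then 2 else 0) = 0 := by
  have h : 0 < uth := by assumption
  obtain rfl : f = hermiteSum M uth u c := funext hf
  have h0 : c 0 = ρ := by rw [hρ, integral_hermiteSum h]
  have h1 : ∀ i : Fin 3, c (fun j => if j = i then 1 else 0) = 0 := fun i => by
    have := hu i
    rw [integral_mul_hermiteSum h (by omega), h0] at this
    linarith
  refine ⟨h0, h1, ?_⟩
  rw [integral_sq_mul_hermiteSum h hM] at huth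
  simp only [h0, h1, Fin.sum_univ_three] at huth ⊢
  linarith
end

section
/- Let u ∈ ℝ³, u_th > 0, and let α ∈ ℕ³ be a multi-index. Then for every polynomial p : ℝ³ → ℝ of total degree strictly less than |α| = α₁ + α₂ + α₃, one has ∫_{ℝ³} p(v) 𝓗_{u_th,α}((v − u)/√u_th) dv = 0. In particular, for |α| ≥ 2 the basis function 𝓗_{u_th,α} has vanishing mass and momentum moments: ∫ 𝓗_{u_th,α}((v−u)/√u_th) dv = 0 and ∫ v_i 𝓗_{u_th,α}((v−u)/√u_th) dv = 0 for i = 1,2,3. -/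
open MeasureTheory Real

/-- Polynomials are integrable against the Gaussian weight. -/
theorem integrable_eval_mul_gaussian (q : Polynomial ℝ) :
    Integrable fun x : ℝ => q.eval x * Real.exp (-(x ^ 2) / 2) := by
  have h_pow (n : ℕ) : Integrable fun x : ℝ => x ^ n * Real.exp (-(x ^ 2) / 2) := by
    have h := integrable_rpow_mul_exp_neg_mul_sq (b := 1 / 2) (by norm_num)
      (s := (n : ℝ)) (by linarith [n.cast_nonneg (α := ℝ)])
    refine h.congr (ae_of_all _ fun x => ?_)
    simp only [Real.rpow_natCast]
    congr 2
    ring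
  simp only [Polynomial.eval_eq_sum_range, Finset.sum_mul, mul_assoc]
  exact integrable_finsetSum _ fun n _ => (h_pow n).const_mul _

/-- Orthogonality of the Hermite polynomials to all polynomials of lower degree. -/
theorem integral_eval_mul_hermite_mul_gaussian (n : ℕ) (q : Polynomial ℝ) (hq : q.degree < n) :
    ∫ x : ℝ, (q * (Polynomial.hermite n).map (Int.castRingHom ℝ)).eval x *
      Real.exp (-(x ^ 2) / 2) = 0 := by
  induction n generalizing q with
  | zero =>
    have h0 : q = 0 := by simpa using hq
    simp [h0]
  | succ n ih =>
    set h := (Polynomial.hermite n).map (Int.castRingHom ℝ) with hh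
    have h_succ : (Polynomial.hermite (n + 1)).map (Int.castRingHom ℝ) =
        Polynomial.X * h - Polynomial.derivative h := by
      simp [Polynomial.hermite_succ, hh, Polynomial.derivative_map]
    have h_deg : (Polynomial.derivative q).degree < n := by
      rcases eq_or_ne q 0 with rfl | h0
      · simp
      · refine (Polynomial.degree_derivative_lt h0).trans_le ?_
        exact Polynomial.degree_le_of_natDegree_le
          (Nat.le_of_lt_succ ((Polynomial.natDegree_lt_iff_degree_lt h0).2 hq))
    have h_deriv (x : ℝ) : HasDerivAt (fun y : ℝ => (q * h).eval y * Real.exp (-(y ^ 2) / 2))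
        ((Polynomial.derivative q * h).eval x * Real.exp (-(x ^ 2) / 2) -
          (q * (Polynomial.X * h - Polynomial.derivative h)).eval x *
            Real.exp (-(x ^ 2) / 2)) x := by
      have h_exp : HasDerivAt (fun y : ℝ => Real.exp (-(y ^ 2) / 2))
          (Real.exp (-(x ^ 2) / 2) * (-x)) x := by
        refine ((hasDerivAt_pow 2 x).fun_neg.div_const 2).exp.congr_deriv ?_
        simp
        ring
      refine (((q * h).hasDerivAt x).fun_mul h_exp).congr_deriv ?_
      simp
      ring
    have h_zero := integral_eq_zero_of_hasDerivAt_of_integrable h_deriv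
      ((integrable_eval_mul_gaussian _).sub (integrable_eval_mul_gaussian _))
      (integrable_eval_mul_gaussian _)
    rw [integral_sub (integrable_eval_mul_gaussian _) (integrable_eval_mul_gaussian _),
      ih _ h_deg] at h_zero
    rw [h_succ]
    linarith

theorem He_natCast_s14 (n : ℕ) (x : ℝ) :
    He n x = ((Polynomial.hermite n).map (Int.castRingHom ℝ)).eval x := by
  have h := Polynomial.hermite_eq_deriv_gaussian' n x
  have h_fun : (fun y : ℝ => Real.exp (-(y ^ 2) / 2)) = fun y => Real.exp (-(y ^ 2 / 2)) := by
    funext y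
    rw [neg_div]
  rw [Polynomial.aeval_def, algebraMap_int_eq] at h
  rw [Polynomial.eval_map, h, He, if_neg (by simp), Int.toNat_natCast, h_fun,
    iteratedDeriv_eq_iterate]
  ring

/-- After an affine change of variables, a monomial times a Hermite function is a
polynomial times the Gaussian weight. -/
theorem pow_mul_He_mul_gaussian_comp_div (n k : ℕ) (u s : ℝ) (hs : s ≠ 0) (v : ℝ) :
    v ^ k * (He n ((v - u) / s) * Real.exp (-((v - u) / s) ^ 2 / 2)) =
      (fun x => ((Polynomial.C s * Polynomial.X + Polynomial.C u) ^ k *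
        (Polynomial.hermite n).map (Int.castRingHom ℝ)).eval x * Real.exp (-(x ^ 2) / 2))
        ((v - u) / s) := by
  have hv : s * ((v - u) / s) + u = v := by
    field_simp
    ring
  simp only [He_natCast_s14, Polynomial.eval_mul, Polynomial.eval_pow, Polynomial.eval_add,
    Polynomial.eval_C, Polynomial.eval_X, hv]
  ring

theorem integrable_pow_mul_He_mul_gaussian (n k : ℕ) (u s : ℝ) (hs : s ≠ 0) :
    Integrable fun v : ℝ => v ^ k *
      (He n ((v - u) / s) * Real.exp (-((v - u) / s) ^ 2 / 2)) := by
  simp only [pow_mul_He_mul_gaussian_comp_div n k u s hs]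
  exact ((integrable_eval_mul_gaussian _).comp_div hs).comp_sub_right u

theorem integral_pow_mul_He_mul_gaussian (n k : ℕ) (u s : ℝ) (hs : s ≠ 0) (hk : k < n) :
    ∫ v : ℝ, v ^ k * (He n ((v - u) / s) * Real.exp (-((v - u) / s) ^ 2 / 2)) = 0 := by
  simp only [pow_mul_He_mul_gaussian_comp_div n k u s hs]
  set g : ℝ → ℝ := fun x => ((Polynomial.C s * Polynomial.X + Polynomial.C u) ^ k *
    (Polynomial.hermite n).map (Int.castRingHom ℝ)).eval x * Real.exp (-(x ^ 2) / 2) with hg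
  have h_deg : ((Polynomial.C s * Polynomial.X + Polynomial.C u) ^ k).degree < (n : WithBot ℕ) := by
    rw [Polynomial.degree_pow, Polynomial.degree_linear hs]
    simpa using hk
  rw [integral_sub_right_eq_self (fun v => g (v / s)) u, Measure.integral_comp_div g s, hg,
    integral_eval_mul_hermite_mul_gaussian n _ h_deg, smul_zero]

theorem monomial_mul_hermiteH (u : Fin 3 → ℝ) (uth : ℝ) (α m : Fin 3 → ℕ) (v : Fin 3 → ℝ) :
    (∏ d, v d ^ m d) * hermiteH uth (fun d => (α d : ℤ))
        (fun d => (v d - u d) / Real.sqrt uth) =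
      ∏ d, ((Real.sqrt (2 * π))⁻¹ * uth ^ ((-(((α d : ℕ) : ℤ) : ℝ) - 1) / 2)) * (v d ^ m d *
        (He (α d) ((v d - u d) / Real.sqrt uth) *
          Real.exp (-((v d - u d) / Real.sqrt uth) ^ 2 / 2))) := by
  rw [hermiteH, ← Finset.prod_mul_distrib]
  exact Finset.prod_congr rfl fun d _ => by ring

theorem integrable_monomial_mul_hermiteH (u : Fin 3 → ℝ) (uth : ℝ) (huth : 0 < uth)
    (α m : Fin 3 → ℕ) :
    Integrable fun v : Fin 3 → ℝ => (∏ d, v d ^ m d) * hermiteH uth (fun d => (α d : ℤ))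
      (fun d => (v d - u d) / Real.sqrt uth) := by
  simp only [monomial_mul_hermiteH]
  exact Integrable.fintype_prod (f := fun d (x : ℝ) =>
    ((Real.sqrt (2 * π))⁻¹ * uth ^ ((-(((α d : ℕ) : ℤ) : ℝ) - 1) / 2)) * (x ^ m d *
        (He (α d) ((x - u d) / Real.sqrt uth) *
          Real.exp (-((x - u d) / Real.sqrt uth) ^ 2 / 2)))) fun d =>
    (integrable_pow_mul_He_mul_gaussian _ _ _ _ (Real.sqrt_pos.2 huth).ne').const_mul _

theorem integral_monomial_mul_hermiteH (u : Fin 3 → ℝ) (uth : ℝ) (huth : 0 < uth)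
    (α m : Fin 3 → ℕ) (hm : ∑ d, m d < ∑ d, α d) :
    ∫ v : Fin 3 → ℝ, (∏ d, v d ^ m d) * hermiteH uth (fun d => (α d : ℤ))
      (fun d => (v d - u d) / Real.sqrt uth) = 0 := by
  obtain ⟨d, _, hd⟩ := Finset.exists_lt_of_sum_lt hm
  simp only [monomial_mul_hermiteH]
  rw [integral_fintype_prod_volume_eq_prod (f := fun d (x : ℝ) =>
    ((Real.sqrt (2 * π))⁻¹ * uth ^ ((-(((α d : ℕ) : ℤ) : ℝ) - 1) / 2)) * (x ^ m d *
        (He (α d) ((x - u d) / Real.sqrt uth) *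
          Real.exp (-((x - u d) / Real.sqrt uth) ^ 2 / 2))))]
  refine Finset.prod_eq_zero (Finset.mem_univ d) ?_
  rw [integral_const_mul, integral_pow_mul_He_mul_gaussian _ _ _ _ (Real.sqrt_pos.2 huth).ne' hd,
    mul_zero]

theorem integral_eval_mul_hermiteH (u : Fin 3 → ℝ) (uth : ℝ) (huth : 0 < uth) (α : Fin 3 → ℕ)
    (p : MvPolynomial (Fin 3) ℝ) (hp : p.totalDegree < ∑ d, α d) :
    ∫ v : Fin 3 → ℝ, MvPolynomial.eval v p * hermiteH uth (fun d => (α d : ℤ))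
      (fun d => (v d - u d) / Real.sqrt uth) = 0 := by
  simp only [MvPolynomial.eval_eq', Finset.sum_mul, mul_assoc]
  rw [integral_finsetSum p.support fun (m : Fin 3 →₀ ℕ) _ =>
    (integrable_monomial_mul_hermiteH u uth huth α m).const_mul (p.coeff m)]
  refine Finset.sum_eq_zero fun m hm => ?_
  have h_le : ∑ d, m d ≤ p.totalDegree := by
    simpa [Finsupp.sum_fintype] using MvPolynomial.le_totalDegree hm
  rw [integral_const_mul, integral_monomial_mul_hermiteH u uth huth α m (h_le.trans_lt hp),
    mul_zero]

/-- A Hermite basis function of order `|α|` is orthogonal to all polynomials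
of total degree `< |α|`; in particular, for `|α| ≥ 2` it carries no mass and
no momentum. -/
theorem hermite_basis_moments_vanish
    (u : Fin 3 → ℝ) (uth : ℝ) (huth : 0 < uth) (α : Fin 3 → ℕ) :
    (∀ p : MvPolynomial (Fin 3) ℝ, p.totalDegree < ∑ d, α d →
      (∫ v : Fin 3 → ℝ, MvPolynomial.eval v p *
        hermiteH uth (fun d => (α d : ℤ))
          (fun d => (v d - u d) / Real.sqrt uth)) = 0) ∧
    (2 ≤ ∑ d, α d →
      (∫ v : Fin 3 → ℝ, hermiteH uth (fun d => (α d : ℤ))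
          (fun d => (v d - u d) / Real.sqrt uth)) = 0 ∧
      ∀ i : Fin 3,
        (∫ v : Fin 3 → ℝ, v i * hermiteH uth (fun d => (α d : ℤ))
          (fun d => (v d - u d) / Real.sqrt uth)) = 0) := by
  have h_main := integral_eval_mul_hermiteH u uth huth α
  refine ⟨h_main, fun h => ⟨?_, fun i => ?_⟩⟩
  · simpa using h_main 1 (by rw [MvPolynomial.totalDegree_one]; lia)
  · simpa using h_main (MvPolynomial.X i) (by rw [MvPolynomial.totalDegree_X]; lia)
end
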